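/- arXiv:1707.03843 — 2 statements merged into one kernel-verified Lean document; each statement's English description precedes it below -/
import Mathlib

section
/- Let d ≥ 1 and N ≥ 1 be integers and let ℓ_1, …, ℓ_{d+1} be positive integers with ℓ_i ≤ N for all i and ℓ_i + ℓ_j ≥ N for all 1 ≤ i < j ≤ d+1. For k = 1, …, d define M_k = Σ_{k ≤ i < j ≤ d+1} L_{i,j}. Then for every ν ∈ H_{ℓ,N}^d and every x ∈ V_{ℓ,N}^d, (M_k Q_ν(·;ℓ,N))(x) = |ν^k| (|ℓ^k| − |ν^k| + 1) · Q_ν(x;ℓ,N), where |ν^k| = ν_k+⋯+ν_d and |ℓ^k| = ℓ_k+⋯+ℓ_{d+1}. -/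
open Finset

noncomputable section

/-- Pochhammer symbol `(a)_n = a(a+1)⋯(a+n-1)`. -/
def poch (a : ℝ) (n : ℕ) : ℝ := ∏ k ∈ Finset.range n, (a + k)

/-- One-variable Hahn polynomial. -/
def hahn1 (n : ℕ) (x a b M : ℝ) : ℝ :=
  ∑ k ∈ Finset.range (n + 1),
    poch (-(n : ℝ)) k * poch ((n : ℝ) + a + b + 1) k * poch (-x) k /
      (poch (a + 1) k * poch (-M) k * (Nat.factorial k : ℝ))

/-- The discrete polyhedral domain `V_{ℓ,N}^d`. -/
def polyDomain (d N : ℕ) (ℓ : Fin (d + 1) → ℕ) : Finset (Fin d → ℕ) :=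
  (Fintype.piFinset fun i : Fin d => Finset.range (ℓ i.castSucc + 1)).filter fun x =>
    N - ℓ (Fin.last d) ≤ ∑ i, x i ∧ ∑ i, x i ≤ N

/-- `|ν^{j+1}| = ν_{j+1} + ⋯ + ν_d` (1-indexed). -/
def tailSum (d : ℕ) (ν : Fin d → ℕ) (j : Fin d) : ℕ :=
  ∑ i ∈ Finset.univ.filter (fun i : Fin d => (j : ℕ) < (i : ℕ)), ν i

/-- `|ℓ^{j+1}| = ℓ_{j+1} + ⋯ + ℓ_{d+1}` (1-indexed). -/
def tailSumL (d : ℕ) (ℓ : Fin (d + 1) → ℕ) (j : Fin d) : ℕ :=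
  ∑ i ∈ Finset.univ.filter (fun i : Fin (d + 1) => (j : ℕ) < (i : ℕ)), ℓ i

/-- `|ν^{k}| = ν_k + ⋯ + ν_d`, for `k` corresponding to `k : Fin d` (1-indexed `k+1`…
here the sum starts at the index itself). -/
def tailFrom (d : ℕ) (ν : Fin d → ℕ) (k : Fin d) : ℕ :=
  ∑ i ∈ Finset.univ.filter (fun i : Fin d => (k : ℕ) ≤ (i : ℕ)), ν i

/-- `|ℓ^{k}| = ℓ_k + ⋯ + ℓ_{d+1}`. -/
def tailFromL (d : ℕ) (ℓ : Fin (d + 1) → ℕ) (k : Fin d) : ℕ :=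
  ∑ i ∈ Finset.univ.filter (fun i : Fin (d + 1) => (k : ℕ) ≤ (i : ℕ)), ℓ i

/-- `|x_{j-1}| = x_1 + ⋯ + x_{j-1}` (1-indexed). -/
def headSum (d : ℕ) (x : Fin d → ℝ) (j : Fin d) : ℝ :=
  ∑ i ∈ Finset.univ.filter (fun i : Fin d => (i : ℕ) < (j : ℕ)), x i

/-- The parameter `a_j = -|ℓ^{j+1}| + 2|ν^{j+1}| - 1`. -/
def aCoef (d : ℕ) (ℓ : Fin (d + 1) → ℕ) (ν : Fin d → ℕ) (j : Fin d) : ℝ :=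
  -(tailSumL d ℓ j : ℝ) + 2 * (tailSum d ν j : ℝ) - 1

/-- The index set `H_{ℓ,N}^d`. -/
def indexSet (d N : ℕ) (ℓ : Fin (d + 1) → ℕ) : Set (Fin d → ℕ) :=
  {ν | (∑ i, ν i) ≤ N ∧ (∑ i, ν i) + N ≤ ∑ i, ℓ i ∧
    ∀ j : Fin d, ν j ≤ ℓ j.castSucc ∧ ν j + 2 * tailSum d ν j ≤ tailSumL d ℓ j}

/-- The Hahn polynomial `Q_ν(x; ℓ, N)` on the polyhedron. -/
def hahnQ (d N : ℕ) (ℓ : Fin (d + 1) → ℕ) (ν : Fin d → ℕ) (x : Fin d → ℝ) : ℝ :=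
  ((-1 : ℝ) ^ (∑ i, ν i) / poch (-(N : ℝ)) (∑ i, ν i)) *
    ∏ j : Fin d,
      poch (-(ℓ j.castSucc : ℝ)) (ν j) / poch (aCoef d ℓ ν j + 1) (ν j) *
        poch (-(N : ℝ) + headSum d x j + (tailSum d ν j : ℝ)) (ν j) *
        hahn1 (ν j) (x j) (-(ℓ j.castSucc : ℝ) - 1) (aCoef d ℓ ν j)
          ((N : ℝ) - headSum d x j - (tailSum d ν j : ℝ))

/-- Extended coordinate: `x_k` for `k ≤ d` and `x_{d+1} = N - |x|`. -/
def coordExt (d : ℕ) (N : ℝ) (x : Fin d → ℤ) (k : Fin (d + 1)) : ℝ :=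
  if h : (k : ℕ) < d then (x ⟨k, h⟩ : ℝ) else N - ∑ i, (x i : ℝ)

/-- The shift vector: `e_k` for `k ≤ d`, and `0` for `k = d+1`. -/
def shiftVec (d : ℕ) (k : Fin (d + 1)) : Fin d → ℤ :=
  if h : (k : ℕ) < d then Pi.single ⟨k, h⟩ 1 else 0

/-- The operator `L_{i,j}`, for `i ≠ j ∈ {1,…,d+1}`. -/
def Lop (d : ℕ) (N : ℝ) (ℓ : Fin (d + 1) → ℝ) (i j : Fin (d + 1))
    (f : (Fin d → ℤ) → ℝ) : (Fin d → ℤ) → ℝ := fun x =>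
  coordExt d N x j * (coordExt d N x i - ℓ i) *
      (f (x + shiftVec d i - shiftVec d j) - f x) +
    coordExt d N x i * (coordExt d N x j - ℓ j) *
      (f (x + shiftVec d j - shiftVec d i) - f x)

/-- The operator `M_k = Σ_{k ≤ i < j ≤ d+1} L_{i,j}`, where `k : Fin d` corresponds to
the (1-indexed) value `k+1`. -/
def Mop (d : ℕ) (N : ℝ) (ℓ : Fin (d + 1) → ℝ) (k : Fin d)
    (f : (Fin d → ℤ) → ℝ) : (Fin d → ℤ) → ℝ := fun x =>
  ∑ p ∈ Finset.univ.filter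
      (fun p : Fin (d + 1) × Fin (d + 1) => (k : ℕ) ≤ (p.1 : ℕ) ∧ p.1 < p.2),
    Lop d N ℓ p.1 p.2 f x

lemma poch_succ (a : ℝ) (n : ℕ) : poch a (n + 1) = poch a n * (a + n) := by
  simp [poch, Finset.prod_range_succ]

lemma poch_succ' (a : ℝ) (n : ℕ) : poch a (n + 1) = a * poch (a + 1) n := by
  unfold poch
  rw [Finset.prod_range_succ', mul_comm]
  congr 1
  · simp
  · apply Finset.prod_congr rfl
    intro k _
    push_cast
    ring

lemma poch_eq_zero_iff (a : ℝ) (n : ℕ) : poch a n = 0 ↔ ∃ k < n, a + (k : ℝ) = 0 := by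
  simp [poch, Finset.prod_eq_zero_iff]

lemma poch_add (a : ℝ) (k m : ℕ) : poch a (k + m) = poch a k * poch (a + k) m := by
  unfold poch
  rw [Finset.prod_range_add]
  congr 1
  apply Finset.prod_congr rfl
  intro i _
  push_cast
  ring

/-- Coefficients of the Hahn polynomial. -/
def hc (n : ℕ) (a b : ℝ) (k : ℕ) : ℝ :=
  poch (-(n : ℝ)) k * poch ((n : ℝ) + a + b + 1) k / (poch (a + 1) k * (Nat.factorial k : ℝ))

/-- The renormalized Hahn polynomial, polynomial in `x` and `M`. -/
def hF (n : ℕ) (x a b M : ℝ) : ℝ :=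
  ∑ k ∈ Finset.range (n + 1), hc n a b k * poch (-x) k * poch (-M + k) (n - k)

lemma hF_eq (n : ℕ) (x a b M : ℝ) (h : poch (-M) n ≠ 0) :
    poch (-M) n * hahn1 n x a b M = hF n x a b M := by
  unfold hF hahn1 hc
  rw [Finset.mul_sum]
  apply Finset.sum_congr rfl
  intro k hk
  have hk' : k ≤ n := by simpa [Nat.lt_succ_iff] using hk
  have e : poch (-M) n = poch (-M) k * poch (-M + k) (n - k) := by
    rw [← poch_add, Nat.add_sub_cancel' hk']
  have h1 : poch (-M) k ≠ 0 := by
    intro h0; rw [e, h0, zero_mul] at h; exact h rfl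
  rw [e]
  by_cases h2 : poch (a + 1) k = 0
  · simp [h2]
  have h3 : (Nat.factorial k : ℝ) ≠ 0 := by positivity
  field_simp

lemma hF_zero (n x M : ℕ) (a b : ℝ) (hx : x ≤ M) (hM : M < n) : hF n x a b M = 0 := by
  unfold hF
  apply Finset.sum_eq_zero
  intro k hk
  by_cases h : k ≤ M
  · have : poch (-(M : ℝ) + k) (n - k) = 0 := by
      rw [poch_eq_zero_iff]
      refine ⟨M - k, by omega, ?_⟩
      push_cast [Nat.cast_sub h]
      ring
    rw [this, mul_zero]
  · have : poch (-(x : ℝ)) k = 0 := by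
      rw [poch_eq_zero_iff]
      exact ⟨x, by omega, by ring⟩
    rw [this]; ring

lemma hF_down (n : ℕ) (x a b M : ℝ) :
    x * hF n (x - 1) a b (M - 1) + (M - x) * hF n x a b (M - 1) = (M - n) * hF n x a b M := by
  unfold hF
  rw [Finset.mul_sum, Finset.mul_sum, Finset.mul_sum, ← Finset.sum_add_distrib]
  apply Finset.sum_congr rfl
  intro k hk
  have hk' : k ≤ n := by simpa [Nat.lt_succ_iff] using hk
  have e1 : x * poch (-(x - 1)) k = (x - k) * poch (-x) k := by
    have h1 := poch_succ (-x) k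
    have h2 := poch_succ' (-x) k
    rw [show -(x - 1) = -x + 1 by ring]
    linarith
  have e2 : (M - k) * poch (-(M - 1) + k) (n - k) = (M - n) * poch (-M + k) (n - k) := by
    have h1 := poch_succ (-M + k) (n - k)
    have h2 := poch_succ' (-M + k) (n - k)
    rw [show -(M - 1) + (k : ℝ) = -M + k + 1 by ring]
    push_cast [Nat.cast_sub hk'] at h1 h2
    linarith
  linear_combination hc n a b k * poch (-(M - 1) + k) (n - k) * e1 + hc n a b k * poch (-x) k * e2

lemma hF_up (n : ℕ) (x a b M : ℝ) (ha : ∀ k < n, a + 1 + (k : ℝ) ≠ 0) :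
    (x + a + 1) * hF n (x + 1) a b (M + 1) + (M - x + b + 1) * hF n x a b (M + 1)
      = (M + a + b + 2 + n) * hF n x a b M := by
  have hterm : ∀ k : ℕ, (x + a + 1) * poch (-(x + 1)) (k + 1) + (M - x + b + 1) * poch (-x) (k + 1)
      = (M + a + b + 2 + (k + 1)) * poch (-x) (k + 1) - (k + 1) * (a + (k + 1)) * poch (-x) k := by
    intro k
    have h1 := poch_succ (-x) k
    have h2 := poch_succ' (-(x + 1)) k
    rw [show -(x + 1) + 1 = -x by ring] at h2
    rw [h1, h2]
    ring
  have hcs : ∀ k < n, hc n a b (k + 1) * ((k + 1) * (a + (k + 1)))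
      = hc n a b k * ((k - n) * (n + a + b + 1 + k)) := by
    intro k hk
    unfold hc
    have h0 : poch (a + 1) k ≠ 0 := by
      rw [Ne, poch_eq_zero_iff]
      rintro ⟨i, hi, h⟩
      exact ha i (by omega) h
    have h1 := ha k hk
    have h2 : (Nat.factorial k : ℝ) ≠ 0 := by positivity
    have h3 : (k + 1 : ℝ) ≠ 0 := by positivity
    rw [poch_succ, poch_succ, poch_succ, Nat.factorial_succ]
    push_cast
    field_simp
    ring
  have hL : (x + a + 1) * hF n (x + 1) a b (M + 1) + (M - x + b + 1) * hF n x a b (M + 1)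
      = ∑ k ∈ Finset.range (n + 1), hc n a b k * poch (-(M + 1) + k) (n - k) *
          ((M + a + b + 2 + k) * poch (-x) k)
        - ∑ k ∈ Finset.range n, hc n a b (k + 1) * poch (-(M + 1) + (k + 1)) (n - (k + 1)) *
          ((k + 1) * (a + (k + 1)) * poch (-x) k) := by
    unfold hF
    rw [Finset.mul_sum, Finset.mul_sum, ← Finset.sum_add_distrib, Finset.sum_range_succ',
      Finset.sum_range_succ' _ n, add_sub_right_comm, ← Finset.sum_sub_distrib]
    congr 1
    · apply Finset.sum_congr rfl
      intro k _
      have := hterm k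
      push_cast
      linear_combination hc n a b (k + 1) * poch (-(M + 1) + (k + 1)) (n - (k + 1)) * this
    · simp [poch]
      ring
  rw [hL, Finset.sum_range_succ]
  unfold hF
  rw [Finset.sum_range_succ, mul_add, add_sub_right_comm, ← Finset.sum_sub_distrib, Finset.mul_sum]
  congr 1
  · apply Finset.sum_congr rfl
    intro k hk
    have hk' : k < n := by simpa using hk
    obtain ⟨r, rfl⟩ : ∃ r, n = k + r + 1 := ⟨n - k - 1, by omega⟩
    have h := hcs k hk'
    rw [show k + r + 1 - k = r + 1 by omega, show k + r + 1 - (k + 1) = r by omega,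
      poch_succ', poch_succ]
    rw [show -(M + 1) + ((k : ℝ) + 1) = -M + k by ring, show -(M + 1) + (k : ℝ) + 1 = -M + k by ring]
    push_cast at h ⊢
    linear_combination (-poch (-M + k) r * poch (-x) k) * h
  · simp [poch]
    ring

/-- Sum of `f i` over `i ≥ k`. -/
def tS {n : ℕ} (f : Fin n → ℝ) (k : ℕ) : ℝ :=
  ∑ i ∈ Finset.univ.filter (fun i : Fin n => k ≤ (i : ℕ)), f i

lemma filter_ge {n : ℕ} (k : ℕ) (h : k < n) :
    Finset.univ.filter (fun i : Fin n => k ≤ (i : ℕ)) =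
      insert ⟨k, h⟩ (Finset.univ.filter (fun i : Fin n => k + 1 ≤ (i : ℕ))) := by
  ext i
  simp [Fin.ext_iff]
  omega

lemma tS_split {n : ℕ} (f : Fin n → ℝ) (k : ℕ) (h : k < n) :
    tS f k = f ⟨k, h⟩ + tS f (k + 1) := by
  unfold tS
  rw [filter_ge k h, Finset.sum_insert (by simp)]

lemma tS_end {n : ℕ} (f : Fin n → ℝ) (k : ℕ) (h : n ≤ k) : tS f k = 0 := by
  unfold tS
  apply Finset.sum_eq_zero
  intro i hi
  simp at hi
  omega

lemma tS_add {n : ℕ} (f g : Fin n → ℝ) (k : ℕ) : tS (f + g) k = tS f k + tS g k := by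
  simp [tS, Finset.sum_add_distrib]

lemma tS_single {n : ℕ} (i : Fin n) (c : ℝ) (k : ℕ) :
    tS (Pi.single i c) k = if k ≤ (i : ℕ) then c else 0 := by
  unfold tS
  simp [Finset.sum_pi_single]

/-- The factor of the polyhedral Hahn polynomial, in homogeneous coordinates. -/
def gF (d : ℕ) (ℓ : Fin (d + 1) → ℕ) (ν : Fin d → ℕ) (X : Fin (d + 1) → ℝ) (j : Fin d) : ℝ :=
  hF (ν j) (X j.castSucc) (-(ℓ j.castSucc : ℝ) - 1) (aCoef d ℓ ν j)
    (tS X j - tS (fun i => (ν i : ℝ)) (j + 1))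

/-- Product of the factors with index `≥ k`. -/
def gG (d : ℕ) (ℓ : Fin (d + 1) → ℕ) (ν : Fin d → ℕ) (k : ℕ) (X : Fin (d + 1) → ℝ) : ℝ :=
  ∏ j ∈ Finset.univ.filter (fun j : Fin d => k ≤ (j : ℕ)), gF d ℓ ν X j

lemma gG_split (d : ℕ) (ℓ : Fin (d + 1) → ℕ) (ν : Fin d → ℕ) (k : ℕ) (X : Fin (d + 1) → ℝ)
    (h : k < d) : gG d ℓ ν k X = gF d ℓ ν X ⟨k, h⟩ * gG d ℓ ν (k + 1) X := by
  unfold gG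
  rw [filter_ge k h, Finset.prod_insert (by simp)]

lemma gF_congr (d : ℕ) (ℓ : Fin (d + 1) → ℕ) (ν : Fin d → ℕ) (X Y : Fin (d + 1) → ℝ) (j : Fin d)
    (h1 : X j.castSucc = Y j.castSucc) (h2 : tS X j = tS Y j) : gF d ℓ ν X j = gF d ℓ ν Y j := by
  unfold gF
  rw [h1, h2]

lemma gG_shift_lt (d : ℕ) (ℓ : Fin (d + 1) → ℕ) (ν : Fin d → ℕ) (k : ℕ) (X : Fin (d + 1) → ℝ)
    (i : Fin (d + 1)) (hi : (i : ℕ) < k) (c : ℝ) :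
    gG d ℓ ν k (X + Pi.single i c) = gG d ℓ ν k X := by
  unfold gG
  apply Finset.prod_congr rfl
  intro j hj
  simp at hj
  apply gF_congr
  · have : j.castSucc ≠ i := by
      intro h; rw [← h] at hi; simp at hi; omega
    simp [this]
  · rw [tS_add, tS_single, if_neg (by omega), add_zero]

lemma gF_shift_gt (d : ℕ) (ℓ : Fin (d + 1) → ℕ) (ν : Fin d → ℕ) (X : Fin (d + 1) → ℝ)
    (i : Fin (d + 1)) (j : Fin d) (hi : (j : ℕ) < i) (c : ℝ) :
    gF d ℓ ν (X + Pi.single i c) j = hF (ν j) (X j.castSucc) (-(ℓ j.castSucc : ℝ) - 1)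
      (aCoef d ℓ ν j) (tS X j - tS (fun i => (ν i : ℝ)) (j + 1) + c) := by
  unfold gF
  have : j.castSucc ≠ i := by
    intro h; rw [← h] at hi; simp at hi
  rw [tS_add, tS_single, if_pos (by omega)]
  simp only [Pi.add_apply, Pi.single_eq_of_ne this, add_zero]
  congr 1
  ring

lemma gF_shift_self (d : ℕ) (ℓ : Fin (d + 1) → ℕ) (ν : Fin d → ℕ) (X : Fin (d + 1) → ℝ)
    (j : Fin d) (c : ℝ) :
    gF d ℓ ν (X + Pi.single j.castSucc c) j =
      hF (ν j) (X j.castSucc + c) (-(ℓ j.castSucc : ℝ) - 1)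
      (aCoef d ℓ ν j) (tS X j - tS (fun i => (ν i : ℝ)) (j + 1) + c) := by
  unfold gF
  rw [tS_add, tS_single, if_pos (by simp)]
  simp only [Pi.add_apply, Pi.single_eq_same]
  congr 1
  ring

/-- One step of the recursion for weighted sums of shifts. -/
lemma gG_sum_step (d : ℕ) (ℓ : Fin (d + 1) → ℕ) (ν : Fin d → ℕ) (k : ℕ) (h : k < d)
    (X w : Fin (d + 1) → ℝ) (c : ℝ) :
    tS (fun i => w i * gG d ℓ ν k (X + Pi.single i c)) k =
      w (Fin.castSucc ⟨k, h⟩) * hF (ν ⟨k, h⟩) (X (Fin.castSucc ⟨k, h⟩) + c)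
        (-(ℓ (Fin.castSucc ⟨k, h⟩) : ℝ) - 1) (aCoef d ℓ ν ⟨k, h⟩)
        (tS X k - tS (fun i => (ν i : ℝ)) (k + 1) + c) * gG d ℓ ν (k + 1) X
      + hF (ν ⟨k, h⟩) (X (Fin.castSucc ⟨k, h⟩))
        (-(ℓ (Fin.castSucc ⟨k, h⟩) : ℝ) - 1) (aCoef d ℓ ν ⟨k, h⟩)
        (tS X k - tS (fun i => (ν i : ℝ)) (k + 1) + c) *
        tS (fun i => w i * gG d ℓ ν (k + 1) (X + Pi.single i c)) (k + 1) := by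
  rw [tS_split _ k (by omega)]
  congr 1
  · rw [gG_split _ _ _ _ _ h, gG_shift_lt _ _ _ _ _ _ (by simp)]
    have := gF_shift_self d ℓ ν X ⟨k, h⟩ c
    simp only [Fin.castSucc_mk] at this ⊢
    rw [this]
    ring
  · unfold tS
    rw [Finset.mul_sum]
    apply Finset.sum_congr rfl
    intro i hi
    simp at hi
    dsimp only
    rw [gG_split _ _ _ _ _ h, gF_shift_gt _ _ _ _ _ _ (by simp; omega)]
    unfold tS
    ring

lemma gG_down (d : ℕ) (ℓ : Fin (d + 1) → ℕ) (ν : Fin d → ℕ) (k : ℕ) (hk : k ≤ d)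
    (X : Fin (d + 1) → ℝ) :
    tS (fun i => X i * gG d ℓ ν k (X + Pi.single i (-1))) k =
      (tS X k - tS (fun i => (ν i : ℝ)) k) * gG d ℓ ν k X := by
  induction hk using Nat.decreasingInduction with
  | self =>
    have h1 : ∀ Y, gG d ℓ ν d Y = 1 := by
      intro Y
      unfold gG
      apply Finset.prod_eq_one
      intro j hj
      simp at hj
      omega
    simp only [h1, tS_end (fun i => (ν i : ℝ)) d le_rfl]
    simp
  | of_succ k h ih =>
    rw [gG_sum_step _ _ _ _ h, ih, gG_split _ _ _ _ _ h]
    have hd := hF_down (ν ⟨k, h⟩) (X (Fin.castSucc ⟨k, h⟩)) (-(ℓ (Fin.castSucc ⟨k, h⟩) : ℝ) - 1)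
      (aCoef d ℓ ν ⟨k, h⟩) (tS X k - tS (fun i => (ν i : ℝ)) (k + 1))
    have hX := tS_split X k (by omega)
    have hv := tS_split (fun i => (ν i : ℝ)) k h
    unfold gF
    simp only [Fin.castSucc_mk] at *
    simp only [← sub_eq_add_neg]
    have e1 : tS X (k + 1) = tS X k - X ⟨k, by omega⟩ := by linarith
    rw [e1, hv]
    linear_combination gG d ℓ ν (k + 1) X * hd

lemma gG_up (d : ℕ) (ℓ : Fin (d + 1) → ℕ) (ν : Fin d → ℕ) (hν : ∀ j, ν j ≤ ℓ j.castSucc)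
    (k : ℕ) (hk : k ≤ d) (X : Fin (d + 1) → ℝ) :
    tS (fun i => (X i - ℓ i) * gG d ℓ ν k (X + Pi.single i 1)) k =
      (tS X k - tS (fun i => (ℓ i : ℝ)) k + tS (fun i => (ν i : ℝ)) k) * gG d ℓ ν k X := by
  induction hk using Nat.decreasingInduction with
  | self =>
    have h1 : ∀ Y, gG d ℓ ν d Y = 1 := by
      intro Y
      unfold gG
      apply Finset.prod_eq_one
      intro j hj
      simp at hj
      omega
    simp only [h1, tS_end (fun i => (ν i : ℝ)) d le_rfl]
    simp [tS]
  | of_succ k h ih =>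
    rw [gG_sum_step _ _ _ _ h, ih, gG_split _ _ _ _ _ h]
    have hd := hF_up (ν ⟨k, h⟩) (X (Fin.castSucc ⟨k, h⟩)) (-(ℓ (Fin.castSucc ⟨k, h⟩) : ℝ) - 1)
      (aCoef d ℓ ν ⟨k, h⟩) (tS X k - tS (fun i => (ν i : ℝ)) (k + 1)) (by
        intro i hi h0
        have h1 := hν ⟨k, h⟩
        have h2 : (i : ℝ) = (ℓ (Fin.castSucc ⟨k, h⟩) : ℝ) := by linarith
        have h3 : i = ℓ (Fin.castSucc ⟨k, h⟩) := by exact_mod_cast h2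
        omega)
    have hX := tS_split X k (by omega)
    have hv := tS_split (fun i => (ν i : ℝ)) k h
    have hl := tS_split (fun i => (ℓ i : ℝ)) k (by omega)
    have ha : aCoef d ℓ ν ⟨k, h⟩ = -tS (fun i => (ℓ i : ℝ)) (k + 1)
        + 2 * tS (fun i => (ν i : ℝ)) (k + 1) - 1 := by
      unfold aCoef tailSum tailSumL tS
      push_cast
      rfl
    unfold gF
    simp only [Fin.castSucc_mk] at *
    have e1 : tS X (k + 1) = tS X k - X ⟨k, by omega⟩ := by linarith
    rw [e1, hv, hl]
    generalize hF (ν ⟨k, h⟩) (X ⟨k, by omega⟩) (-(ℓ ⟨k, by omega⟩ : ℝ) - 1) (aCoef d ℓ ν ⟨k, h⟩)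
      (tS X k - tS (fun i => (ν i : ℝ)) (k + 1)) = A at *
    generalize hF (ν ⟨k, h⟩) (X ⟨k, by omega⟩) (-(ℓ ⟨k, by omega⟩ : ℝ) - 1) (aCoef d ℓ ν ⟨k, h⟩)
      (tS X k - tS (fun i => (ν i : ℝ)) (k + 1) + 1) = B at *
    generalize hF (ν ⟨k, h⟩) (X ⟨k, by omega⟩ + 1) (-(ℓ ⟨k, by omega⟩ : ℝ) - 1)
      (aCoef d ℓ ν ⟨k, h⟩) (tS X k - tS (fun i => (ν i : ℝ)) (k + 1) + 1) = D at *
    rw [ha] at hd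
    linear_combination gG d ℓ ν (k + 1) X * hd

lemma gG_eigen (d : ℕ) (ℓ : Fin (d + 1) → ℕ) (ν : Fin d → ℕ) (hν : ∀ j, ν j ≤ ℓ j.castSucc)
    (k : ℕ) (hk : k ≤ d) (X : Fin (d + 1) → ℝ) :
    tS (fun j => tS (fun i => X j * (X i - ℓ i) *
        (gG d ℓ ν k (X + Pi.single j (-1) + Pi.single i 1) - gG d ℓ ν k X)) k) k =
      tS (fun i => (ν i : ℝ)) k * (tS (fun i => (ℓ i : ℝ)) k - tS (fun i => (ν i : ℝ)) k + 1) *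
        gG d ℓ ν k X := by
  have hin : ∀ j : Fin (d + 1), k ≤ (j : ℕ) → tS (fun i => X j * (X i - ℓ i) *
        (gG d ℓ ν k (X + Pi.single j (-1) + Pi.single i 1) - gG d ℓ ν k X)) k =
      (tS X k - 1 - tS (fun i => (ℓ i : ℝ)) k + tS (fun i => (ν i : ℝ)) k) *
        (X j * gG d ℓ ν k (X + Pi.single j (-1))) +
      X j * (gG d ℓ ν k X * (1 - (tS X k - tS (fun i => (ℓ i : ℝ)) k))) := by
    intro j hj
    have hu := gG_up d ℓ ν hν k hk (X + Pi.single j (-1))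
    rw [tS_add, tS_single, if_pos hj] at hu
    have e1 : tS (fun i => X j * (X i - ℓ i) *
        (gG d ℓ ν k (X + Pi.single j (-1) + Pi.single i 1) - gG d ℓ ν k X)) k =
        X j * (tS (fun i => ((X + Pi.single j (-1) : Fin (d + 1) → ℝ) i - ℓ i) *
          gG d ℓ ν k (X + Pi.single j (-1) + Pi.single i 1)) k)
        + X j * tS (Pi.single j (gG d ℓ ν k X)) k
        - X j * gG d ℓ ν k X * (tS X k - tS (fun i => (ℓ i : ℝ)) k) := by
      unfold tS
      rw [← Finset.sum_sub_distrib, Finset.mul_sum, Finset.mul_sum, Finset.mul_sum,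
        ← Finset.sum_add_distrib, ← Finset.sum_sub_distrib]
      apply Finset.sum_congr rfl
      intro i _
      by_cases hij : i = j
      · subst hij
        have : X + Pi.single i (-1) + Pi.single i 1 = X := by
          rw [add_assoc, ← Pi.single_add]; simp
        dsimp only
        rw [this]
        simp
        ring
      · simp [hij]
        ring
    rw [e1, hu, tS_single, if_pos hj]
    ring
  have hdn := gG_down d ℓ ν k hk X
  have e2 : tS (fun j => tS (fun i => X j * (X i - ℓ i) *
        (gG d ℓ ν k (X + Pi.single j (-1) + Pi.single i 1) - gG d ℓ ν k X)) k) k =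
      (tS X k - 1 - tS (fun i => (ℓ i : ℝ)) k + tS (fun i => (ν i : ℝ)) k) *
        tS (fun j => X j * gG d ℓ ν k (X + Pi.single j (-1))) k +
      tS X k * (gG d ℓ ν k X * (1 - (tS X k - tS (fun i => (ℓ i : ℝ)) k))) := by
    rw [tS, Finset.sum_congr rfl (fun j hj => hin j (Finset.mem_filter.mp hj).2)]
    rw [Finset.sum_add_distrib, ← Finset.mul_sum, ← Finset.sum_mul]
    rfl
  rw [e2, hdn]
  ring

/-- The shift by `e_i - e_j` with `i, j ≥ k` only touches the factors with index `≥ k`. -/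
lemma gG_head (d : ℕ) (ℓ : Fin (d + 1) → ℕ) (ν : Fin d → ℕ) (k : ℕ) :
    ∀ X : Fin (d + 1) → ℝ, ∃ C : ℝ, gG d ℓ ν 0 X = C * gG d ℓ ν k X ∧
      ∀ i j : Fin (d + 1), k ≤ (i : ℕ) → k ≤ (j : ℕ) →
      gG d ℓ ν 0 (X + Pi.single j (-1) + Pi.single i 1) =
        C * gG d ℓ ν k (X + Pi.single j (-1) + Pi.single i 1) := by
  intro X
  have hsplit : ∀ Y, gG d ℓ ν 0 Y =
      (∏ j ∈ Finset.univ.filter (fun j : Fin d => ¬ k ≤ (j : ℕ)), gF d ℓ ν Y j) * gG d ℓ ν k Y := by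
    intro Y
    unfold gG
    rw [mul_comm, Finset.prod_filter_mul_prod_filter_not]
    simp
  refine ⟨_, hsplit X, ?_⟩
  intro i j hi hj
  rw [hsplit]
  congr 1
  apply Finset.prod_congr rfl
  intro t ht
  simp at ht
  apply gF_congr
  · have h1 : t.castSucc ≠ i := by
      intro h; rw [← h] at hi; simp at hi; omega
    have h2 : t.castSucc ≠ j := by
      intro h; rw [← h] at hj; simp at hj; omega
    simp [h1, h2]
  · rw [tS_add, tS_add, tS_single, tS_single, if_pos (by omega), if_pos (by omega)]
    ring

/-- Vanishing when the tail of the point is smaller than the tail of the degree. -/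
lemma gF_vanish (d : ℕ) (ℓ : Fin (d + 1) → ℕ) (ν : Fin d → ℕ) (X : Fin (d + 1) → ℕ)
    (k : ℕ) (hk : k ≤ d)
    (h : tS (fun i => (X i : ℝ)) k < tS (fun i => (ν i : ℝ)) k) :
    ∃ j : Fin d, gF d ℓ ν (fun i => (X i : ℝ)) j = 0 := by
  induction hk using Nat.decreasingInduction with
  | self =>
    rw [tS_end (fun i => (ν i : ℝ)) d le_rfl] at h
    have : 0 ≤ tS (fun i => (X i : ℝ)) d := Finset.sum_nonneg (fun i _ => by positivity)
    linarith
  | of_succ k hk ih =>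
    by_cases h1 : tS (fun i => (X i : ℝ)) (k + 1) < tS (fun i => (ν i : ℝ)) (k + 1)
    · exact ih h1
    · refine ⟨⟨k, hk⟩, ?_⟩
      have hX := tS_split (fun i => (X i : ℝ)) k (by omega)
      have hv := tS_split (fun i => (ν i : ℝ)) k hk
      unfold gF
      simp only [Fin.castSucc_mk]
      obtain ⟨p, hp⟩ : ∃ p : ℕ, tS (fun i => (X i : ℝ)) (k + 1) = p :=
        ⟨∑ i ∈ Finset.univ.filter (fun i : Fin (d + 1) => k + 1 ≤ (i : ℕ)), X i, by
          unfold tS; push_cast; rfl⟩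
      obtain ⟨q, hq⟩ : ∃ q : ℕ, tS (fun i => (ν i : ℝ)) (k + 1) = q :=
        ⟨∑ i ∈ Finset.univ.filter (fun i : Fin d => k + 1 ≤ (i : ℕ)), ν i, by
          unfold tS; push_cast; rfl⟩
      rw [hp] at hX h1
      rw [hq] at hv h1
      rw [hX, hv] at h
      have h1' : q ≤ p := by
        have := not_lt.mp h1
        exact_mod_cast this
      have h' : X ⟨k, by omega⟩ + p < ν ⟨k, hk⟩ + q := by exact_mod_cast h
      have e : tS (fun i => (X i : ℝ)) k - tS (fun i => (ν i : ℝ)) (k + 1)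
          = ((X ⟨k, by omega⟩ + (p - q) : ℕ) : ℝ) := by
        rw [hX, hq]
        push_cast [Nat.cast_sub h1']
        ring
      rw [e]
      exact hF_zero _ _ _ _ _ (by omega) (by omega)

/-- On the simplex the totalized definition agrees with the polynomial one. -/
lemma prod_simplex (d : ℕ) (ℓ : Fin (d + 1) → ℕ) (ν : Fin d → ℕ) (X : Fin (d + 1) → ℕ) :
    ∏ j : Fin d, (poch (-(tS (fun i => (X i : ℝ)) j - tS (fun i => (ν i : ℝ)) (j + 1))) (ν j) *
      hahn1 (ν j) (X j.castSucc) (-(ℓ j.castSucc : ℝ) - 1) (aCoef d ℓ ν j)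
        (tS (fun i => (X i : ℝ)) j - tS (fun i => (ν i : ℝ)) (j + 1))) =
    gG d ℓ ν 0 (fun i => (X i : ℝ)) := by
  have hg : gG d ℓ ν 0 (fun i => (X i : ℝ)) = ∏ j : Fin d, gF d ℓ ν (fun i => (X i : ℝ)) j := by
    simp [gG]
  rw [hg]
  by_cases hall : ∀ j : Fin d,
      poch (-(tS (fun i => (X i : ℝ)) j - tS (fun i => (ν i : ℝ)) (j + 1))) (ν j) ≠ 0
  · apply Finset.prod_congr rfl
    intro j _
    exact hF_eq _ _ _ _ _ (hall j)
  · push Not at hall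
    obtain ⟨j, hj⟩ := hall
    rw [Finset.prod_eq_zero (Finset.mem_univ j) (by rw [hj, zero_mul])]
    suffices h : ∃ j : Fin d, gF d ℓ ν (fun i => (X i : ℝ)) j = 0 by
      obtain ⟨j, hj⟩ := h
      rw [Finset.prod_eq_zero (Finset.mem_univ j) hj]
    rw [poch_eq_zero_iff] at hj
    obtain ⟨m, hm, hm0⟩ := hj
    have hM : tS (fun i => (X i : ℝ)) j - tS (fun i => (ν i : ℝ)) (j + 1) = m := by linarith
    by_cases hx : X j.castSucc ≤ m
    · refine ⟨j, ?_⟩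
      unfold gF
      rw [hM]
      exact hF_zero _ _ _ _ _ hx hm
    · apply gF_vanish d ℓ ν X (j + 1) (by omega)
      have hX := tS_split (fun i => (X i : ℝ)) j (by omega)
      have : (m : ℝ) < X j.castSucc := by exact_mod_cast not_le.mp hx
      change _ = (X j.castSucc : ℝ) + _ at hX
      linarith

/-- The constant in front of the product. -/
def hK (d N : ℕ) (ℓ : Fin (d + 1) → ℕ) (ν : Fin d → ℕ) : ℝ :=
  ((-1 : ℝ) ^ (∑ i, ν i) / poch (-(N : ℝ)) (∑ i, ν i)) *
    ∏ j : Fin d, (poch (-(ℓ j.castSucc : ℝ)) (ν j) / poch (aCoef d ℓ ν j + 1) (ν j))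

lemma tS_zero {n : ℕ} (f : Fin n → ℝ) : tS f 0 = ∑ i, f i := by simp [tS]

lemma head_tS (d : ℕ) (X : Fin (d + 1) → ℝ) (j : Fin d) :
    headSum d (fun t => X t.castSucc) j + tS X j = ∑ i, X i := by
  have h1 : tS X j = tS (fun t : Fin d => X t.castSucc) j + X (Fin.last d) := by
    unfold tS
    rw [Finset.sum_filter, Finset.sum_filter, Fin.sum_univ_castSucc]
    have : (j : ℕ) ≤ d := by omega
    simp [this]
  rw [h1, Fin.sum_univ_castSucc, ← add_assoc]
  congr 1
  unfold headSum tS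
  rw [← Finset.sum_filter_add_sum_filter_not Finset.univ (fun i : Fin d => (i : ℕ) < (j : ℕ))]
  congr 2
  ext i
  simp

lemma hahnQ_eq (d N : ℕ) (ℓ : Fin (d + 1) → ℕ) (ν : Fin d → ℕ) (X : Fin (d + 1) → ℕ)
    (hX : ∑ i, X i = N) :
    hahnQ d N ℓ ν (fun t => (X t.castSucc : ℝ)) = hK d N ℓ ν * gG d ℓ ν 0 (fun i => (X i : ℝ)) := by
  rw [← prod_simplex]
  unfold hahnQ hK
  rw [mul_assoc, ← Finset.prod_mul_distrib]
  congr 1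
  apply Finset.prod_congr rfl
  intro j _
  have h1 := head_tS d (fun i => (X i : ℝ)) j
  have h2 : (∑ i, (X i : ℝ)) = N := by exact_mod_cast hX
  rw [h2] at h1
  have h3 : (tailSum d ν j : ℝ) = tS (fun i => (ν i : ℝ)) (j + 1) := by
    unfold tailSum tS
    push_cast
    rfl
  have e1 : (N : ℝ) - headSum d (fun t => (X t.castSucc : ℝ)) j - (tailSum d ν j : ℝ) =
      tS (fun i => (X i : ℝ)) j - tS (fun i => (ν i : ℝ)) (j + 1) := by
    rw [h3]; linarith
  have e2 : -(N : ℝ) + headSum d (fun t => (X t.castSucc : ℝ)) j + (tailSum d ν j : ℝ) =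
      -(tS (fun i => (X i : ℝ)) j - tS (fun i => (ν i : ℝ)) (j + 1)) := by
    rw [← e1]; ring
  rw [e1, e2]
  ring

lemma coordExt_shift (d : ℕ) (N : ℝ) (x : Fin d → ℤ) (i j : Fin (d + 1)) :
    coordExt d N (x + shiftVec d i - shiftVec d j) =
      coordExt d N x + Pi.single j (-1) + Pi.single i 1 := by
  have hs : ∀ i : Fin (d + 1), (∑ t, (shiftVec d i t : ℝ)) = if (i : ℕ) < d then 1 else 0 := by
    intro i
    unfold shiftVec
    split_ifs with h
    · rw [← Int.cast_sum]; simp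
    · simp
  have hv : ∀ (i : Fin (d + 1)) (t : Fin d), (shiftVec d i t : ℝ) =
      (Pi.single i 1 : Fin (d + 1) → ℝ) t.castSucc := by
    intro i t
    unfold shiftVec
    split_ifs with h
    · simp only [Pi.single_apply, Fin.ext_iff]
      simp
    · have : t.castSucc ≠ i := by
        intro h'; rw [← h'] at h; simp at h
      simp [this]
  have hn : (Pi.single j (-1) : Fin (d + 1) → ℝ) = -Pi.single j 1 := by
    rw [Pi.single_neg]
  ext t
  rw [hn]
  refine Fin.lastCases ?_ (fun t => ?_) t
  · simp only [coordExt, Pi.add_apply, Pi.sub_apply, Pi.neg_apply, Int.cast_add, Int.cast_sub,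
      Finset.sum_add_distrib, Finset.sum_sub_distrib, hs]
    have hl : ∀ i : Fin (d + 1), (Pi.single i 1 : Fin (d + 1) → ℝ) (Fin.last d) =
        1 - if (i : ℕ) < d then 1 else 0 := by
      intro i
      by_cases h : (i : ℕ) < d
      · have : Fin.last d ≠ i := by
          intro h'; rw [← h'] at h; simp at h
        simp [h, this]
      · have : i = Fin.last d := by
          ext; simp; omega
        subst this
        simp
    simp [hl]
    ring
  · have h1 := hv i t
    have h2 := hv j t
    have : (t.castSucc : ℕ) < d := by simp
    simp only [coordExt, Pi.add_apply, Pi.sub_apply, Pi.neg_apply, this, dif_pos, Int.cast_add,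
      Int.cast_sub]
    simp only [Fin.val_castSucc, Fin.eta]
    rw [h1, h2]
    ring

/-- Sum over ordered pairs of a symmetrized function with zero diagonal. -/
lemma pair_sum (n k : ℕ) (A : Fin n → Fin n → ℝ) (hA : ∀ i, A i i = 0) :
    ∑ p ∈ Finset.univ.filter (fun p : Fin n × Fin n => k ≤ (p.1 : ℕ) ∧ p.1 < p.2),
      (A p.1 p.2 + A p.2 p.1) = tS (fun j => tS (fun i => A i j) k) k := by
  have h0 : tS (fun j => tS (fun i => A i j) k) k =
      ∑ i : Fin n, ∑ j : Fin n, if k ≤ (i : ℕ) ∧ k ≤ (j : ℕ) then A i j else 0 := by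
    unfold tS
    rw [Finset.sum_comm, Finset.sum_filter]
    apply Finset.sum_congr rfl
    intro i _
    split_ifs with h
    · rw [Finset.sum_filter]; simp [h]
    · simp [h]
  have h1 : ∑ i : Fin n, ∑ j : Fin n, (if k ≤ (i : ℕ) ∧ k ≤ (j : ℕ) then A i j else 0) =
      ∑ i : Fin n, ∑ j : Fin n, ((if k ≤ (i : ℕ) ∧ i < j then A i j else 0) +
        (if k ≤ (j : ℕ) ∧ j < i then A i j else 0)) := by
    apply Finset.sum_congr rfl
    intro i _
    apply Finset.sum_congr rfl
    intro j _
    rcases lt_trichotomy i j with h | h | h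
    · have h' : (i : ℕ) < j := h
      have h2 : ¬ j < i := not_lt.mpr h.le
      by_cases hk : k ≤ (i : ℕ)
      · have : k ≤ (j : ℕ) := by omega
        simp [h, h2, hk, this]
      · simp [h, h2, hk]
    · subst h; simp [hA]
    · have h' : (j : ℕ) < i := h
      have h2 : ¬ i < j := not_lt.mpr h.le
      by_cases hk : k ≤ (j : ℕ)
      · have : k ≤ (i : ℕ) := by omega
        simp [h, h2, hk, this]
      · simp [h, h2, hk]
  rw [h0, h1, Finset.sum_filter, Fintype.sum_prod_type]
  simp only [Finset.sum_add_distrib]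
  rw [Finset.sum_comm (f := fun i j => if k ≤ ((j : Fin n) : ℕ) ∧ j < i then A i j else 0)]
  rw [← Finset.sum_add_distrib]
  apply Finset.sum_congr rfl
  intro i _
  rw [← Finset.sum_add_distrib]
  apply Finset.sum_congr rfl
  intro j _
  split_ifs <;> simp

/-- `M_k Q_ν = |ν^k|(|ℓ^k| - |ν^k| + 1) Q_ν` on `V_{ℓ,N}^d`. -/
theorem stmt10 (d N : ℕ) (hd : 1 ≤ d) (hN : 1 ≤ N) (ℓ : Fin (d + 1) → ℕ)
    (hpos : ∀ i, 1 ≤ ℓ i) (hle : ∀ i, ℓ i ≤ N)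
    (hpair : ∀ i j : Fin (d + 1), i < j → N ≤ ℓ i + ℓ j)
    (k : Fin d) (ν : Fin d → ℕ) (hν : ν ∈ indexSet d N ℓ)
    (x : Fin d → ℕ) (hx : x ∈ polyDomain d N ℓ) :
    Mop d (N : ℝ) (fun t => (ℓ t : ℝ)) k
        (fun y => hahnQ d N ℓ ν fun t => (y t : ℝ)) (fun t => (x t : ℤ)) =
      (tailFrom d ν k : ℝ) * ((tailFromL d ℓ k : ℝ) - (tailFrom d ν k : ℝ) + 1) *
        hahnQ d N ℓ ν (fun t => (x t : ℝ)) := by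
  obtain ⟨-, -, hν'⟩ := hν
  have hνℓ : ∀ j, ν j ≤ ℓ j.castSucc := fun j => (hν' j).1
  simp only [polyDomain, Finset.mem_filter] at hx
  obtain ⟨-, -, hxN⟩ := hx
  -- homogeneous coordinates of the point
  set X : Fin (d + 1) → ℕ := Fin.snoc (α := fun _ => ℕ) x (N - ∑ i, x i) with hXdef
  have hXc : ∀ t : Fin d, X t.castSucc = x t := fun t => by simp [hXdef]
  have hXl : X (Fin.last d) = N - ∑ i, x i := by simp [hXdef]
  have hXs : ∑ i, X i = N := by
    rw [Fin.sum_univ_castSucc, hXl]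
    simp only [hXc]
    omega
  have hXe : coordExt d (N : ℝ) (fun t => (x t : ℤ)) = fun i => (X i : ℝ) := by
    ext t
    refine Fin.lastCases ?_ (fun t => ?_) t
    · rw [hXl]
      simp [coordExt, Nat.cast_sub hxN]
    · rw [hXc]
      simp [coordExt]
  set f : (Fin d → ℤ) → ℝ := fun y => hahnQ d N ℓ ν fun t => (y t : ℝ) with hf
  have hfx : f (fun t => (x t : ℤ)) = hK d N ℓ ν * gG d ℓ ν 0 (fun i => (X i : ℝ)) := by
    rw [← hahnQ_eq d N ℓ ν X hXs, hf]
    simp [hXc]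
  have hfx' : hahnQ d N ℓ ν (fun t => (x t : ℝ)) =
      hK d N ℓ ν * gG d ℓ ν 0 (fun i => (X i : ℝ)) := by
    rw [← hfx, hf]
    simp
  -- shifted points with nonzero coefficient stay in the simplex
  have hfs : ∀ i j : Fin (d + 1), (X j : ℝ) * (f ((fun t => (x t : ℤ)) + shiftVec d i - shiftVec d j)) =
      (X j : ℝ) * (hK d N ℓ ν *
        gG d ℓ ν 0 ((fun i => (X i : ℝ)) + Pi.single j (-1) + Pi.single i 1)) := by
    intro i j
    rcases Nat.eq_zero_or_pos (X j) with h0 | hpos'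
    · simp [h0]
    congr 1
    have hsj : ∀ t, (Pi.single j 1 : Fin (d + 1) → ℕ) t ≤ X t := by
      intro t
      by_cases h : t = j
      · subst h; simpa using Nat.succ_le_of_lt hpos'
      · simp [h]
    set Y : Fin (d + 1) → ℕ := fun t => X t - (Pi.single j 1 : Fin (d + 1) → ℕ) t +
      (Pi.single i 1 : Fin (d + 1) → ℕ) t with hY
    have hYr : (fun t => (Y t : ℝ)) = (fun i => (X i : ℝ)) + Pi.single j (-1) + Pi.single i 1 := by
      ext t
      have h1 : ∀ i : Fin (d + 1), (((Pi.single i 1 : Fin (d + 1) → ℕ) t : ℕ) : ℝ) =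
          (Pi.single i 1 : Fin (d + 1) → ℝ) t := by
        intro i
        by_cases h : t = i
        · subst h; simp
        · simp [h]
      simp only [hY, Nat.cast_add, Nat.cast_sub (hsj t), h1, Pi.add_apply, Pi.single_neg,
        Pi.neg_apply]
      ring
    have hYs : ∑ t, Y t = N := by
      have h2 : (∑ t, (Y t : ℝ)) = N := by
        have h3 : ∀ t, (Y t : ℝ) = (X t : ℝ) + (Pi.single j (-1) : Fin (d + 1) → ℝ) t +
            (Pi.single i 1 : Fin (d + 1) → ℝ) t := fun t => congrFun hYr t
        simp only [h3, Finset.sum_add_distrib]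
        have h4 : (∑ i, (X i : ℝ)) = N := by exact_mod_cast hXs
        rw [h4]
        simp
      exact_mod_cast h2
    rw [← hYr, ← hahnQ_eq d N ℓ ν Y hYs, hf]
    dsimp only
    congr 1
    ext t
    have h5 := congrFun (coordExt_shift d (N : ℝ) (fun t => (x t : ℤ)) i j) t.castSucc
    rw [hXe, ← hYr] at h5
    dsimp only at h5
    rw [← h5]
    simp [coordExt]
  obtain ⟨C, hC, hCs⟩ := gG_head d ℓ ν k (fun i => (X i : ℝ))
  set A : Fin (d + 1) → Fin (d + 1) → ℝ := fun i j => (X j : ℝ) * ((X i : ℝ) - ℓ i) *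
    (gG d ℓ ν k ((fun i => (X i : ℝ)) + Pi.single j (-1) + Pi.single i 1) -
      gG d ℓ ν k (fun i => (X i : ℝ))) with hA
  have hA0 : ∀ i, A i i = 0 := by
    intro i
    have : (fun i => (X i : ℝ)) + Pi.single i (-1) + Pi.single i 1 = (fun i => (X i : ℝ)) := by
      rw [add_assoc, ← Pi.single_add]; simp
    simp only [hA]
    rw [this]
    ring
  have hM : Mop d (N : ℝ) (fun t => (ℓ t : ℝ)) k f (fun t => (x t : ℤ)) =
      hK d N ℓ ν * C * ∑ p ∈ Finset.univ.filter
        (fun p : Fin (d + 1) × Fin (d + 1) => (k : ℕ) ≤ (p.1 : ℕ) ∧ p.1 < p.2),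
      (A p.1 p.2 + A p.2 p.1) := by
    unfold Mop
    rw [Finset.mul_sum]
    apply Finset.sum_congr rfl
    rintro ⟨i, j⟩ hp
    simp only [Finset.mem_filter, Finset.mem_univ, true_and] at hp
    have hki : (k : ℕ) ≤ i := hp.1
    have hij : (i : ℕ) < j := hp.2
    have hkj : (k : ℕ) ≤ j := by omega
    have e1 := hfs i j
    have e2 := hfs j i
    rw [hCs i j hki hkj] at e1
    rw [hCs j i hkj hki] at e2
    unfold Lop
    rw [hXe, hfx, hC]
    simp only [hA]
    linear_combination ((X i : ℝ) - ℓ i) * e1 + ((X j : ℝ) - ℓ j) * e2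
  rw [hM, pair_sum _ _ _ hA0, hfx', hC]
  have hE := gG_eigen d ℓ ν hνℓ k (by omega) (fun i => (X i : ℝ))
  simp only [hA]
  rw [hE]
  have t1 : (tailFrom d ν k : ℝ) = tS (fun i => (ν i : ℝ)) k := by
    simp [tailFrom, tS]
  have t2 : (tailFromL d ℓ k : ℝ) = tS (fun i => (ℓ i : ℝ)) k := by
    simp [tailFromL, tS]
  rw [t1, t2]
  ring

end
end

section
/- Let d ≥ 3 and N ≥ 1 be integers and let ℓ_1, …, ℓ_{d+1} be nonnegative integers with ℓ_i ≤ N for all i and ℓ_i + ℓ_j ≥ N for all 1 ≤ i < j ≤ d+1. Then the number of lattice points ν ∈ ℕ_0^d satisfying ν_j ≤ ℓ_j for j = 1,…,d, ν_j + 2|ν^{j+1}| ≤ |ℓ^{j+1}| for j = 1,…,d, |ν| ≤ |ℓ| − N, and |ν| ≤ N, equals C(N+d, d) − Σ_{k=1}^{d+1} C(N−ℓ_k+d−1, d), where C(a,b) denotes the binomial coefficient (equal to 0 when a < b). -/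
open Finset

/-- The set `H^d(ℓ₁,…,ℓ_{d+1},N)`: all `ν ∈ ℕ₀^d` with `ν_j ≤ ℓ_j` and
`ν_j + 2|ν^{j+1}| ≤ |ℓ^{j+1}|` for `j = 1,…,d`, `|ν| ≤ |ℓ| - N` and `|ν| ≤ N`. -/
def Hd (d N : ℕ) (ℓ : Fin (d + 1) → ℕ) : Finset (Fin d → ℕ) :=
  (Fintype.piFinset fun _ : Fin d => Finset.range (N + 1)).filter fun ν =>
    (∀ j : Fin d, ν j ≤ ℓ j.castSucc) ∧
    (∀ j : Fin d, ν j + 2 * tailSum d ν j ≤ tailSumL d ℓ j) ∧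
    (∑ i, ν i) + N ≤ ∑ i, ℓ i ∧ (∑ i, ν i) ≤ N

/-- number of points of the box `{0,…,B}^n` satisfying `p` -/
lemma box_card_succ (B n : ℕ) (p : (Fin (n + 1) → ℕ) → Prop) [DecidablePred p] :
    #{x ∈ Fintype.piFinset (fun _ : Fin (n + 1) => Finset.range (B + 1)) | p x} =
      ∑ a ∈ Finset.range (B + 1), ∑ y ∈ Fintype.piFinset (fun _ : Fin n => Finset.range (B + 1)),
        if p (Fin.cons a y) then 1 else 0 := by
  rw [← Finset.sum_product', ← Finset.card_filter]
  symm
  refine Finset.card_bij (fun z _ => Fin.cons z.1 z.2) ?_ ?_ ?_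
  · rintro ⟨a, y⟩ h
    simp only [Finset.mem_filter, Finset.mem_product, Fintype.mem_piFinset] at h ⊢
    exact ⟨fun i => Fin.cases h.1.1 h.1.2 i, h.2⟩
  · rintro ⟨a, y⟩ _ ⟨b, z⟩ _ h
    have := Fin.cons_inj.1 h
    exact Prod.ext this.1 this.2
  · intro x hx
    simp only [Finset.mem_filter, Fintype.mem_piFinset] at hx
    refine ⟨(x 0, Fin.tail x), ?_, by simp⟩
    simp only [Finset.mem_filter, Finset.mem_product, Fintype.mem_piFinset, Fin.cons_self_tail]
    exact ⟨⟨hx.1 0, fun i => hx.1 i.succ⟩, hx.2⟩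

lemma tailSum_zero' (d : ℕ) (a : ℕ) (y : Fin d → ℕ) :
    tailSum (d + 1) (Fin.cons a y) 0 = ∑ i, y i := by
  simp [tailSum, Finset.sum_filter, Fin.sum_univ_succ]

lemma tailSum_succ' (d : ℕ) (a : ℕ) (y : Fin d → ℕ) (j : Fin d) :
    tailSum (d + 1) (Fin.cons a y) j.succ = tailSum d y j := by
  simp [tailSum, Finset.sum_filter, Fin.sum_univ_succ]

lemma tailSumL_zero' (d : ℕ) (ℓ : Fin (d + 2) → ℕ) :
    tailSumL (d + 1) ℓ 0 = ∑ i : Fin (d + 1), ℓ i.succ := by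
  simp [tailSumL, Finset.sum_filter, Fin.sum_univ_succ]

lemma tailSumL_succ' (d : ℕ) (ℓ : Fin (d + 2) → ℕ) (j : Fin d) :
    tailSumL (d + 1) ℓ j.succ = tailSumL d (fun i => ℓ i.succ) j := by
  simp [tailSumL, Finset.sum_filter, Fin.sum_univ_succ (n := d + 1)]

/-- The coupling conditions. -/
def TT (d : ℕ) (ℓ : Fin (d + 1) → ℕ) (ν : Fin d → ℕ) : Prop :=
    (∀ j : Fin d, ν j ≤ ℓ j.castSucc) ∧
    (∀ j : Fin d, ν j + 2 * tailSum d ν j ≤ tailSumL d ℓ j)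

instance (d : ℕ) (ℓ : Fin (d + 1) → ℕ) : DecidablePred (TT d ℓ) := fun _ => by
  unfold TT; infer_instance

lemma TT_cons (d : ℕ) (ℓ : Fin (d + 2) → ℕ) (a : ℕ) (y : Fin d → ℕ) :
    TT (d + 1) ℓ (Fin.cons a y) ↔ TT d (fun i => ℓ i.succ) y ∧
      a ≤ ℓ 0 ∧ a + 2 * ∑ i, y i ≤ ∑ i : Fin (d + 1), ℓ i.succ := by
  unfold TT
  simp only [Fin.forall_fin_succ, tailSum_zero', tailSum_succ', tailSumL_zero', tailSumL_succ',
    Fin.cons_zero, Fin.cons_succ, Fin.castSucc_zero, Fin.succ_castSucc]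
  tauto

lemma interval_card (B N l s M : ℕ) (hB : N ≤ B) :
    #{a ∈ Finset.range (B + 1) | a ≤ l ∧ a ≤ N ∧ s + (N - a) ≤ M ∧ s ≤ N - a} =
    #{a ∈ Finset.range (B + 1) | a ≤ l ∧ a + 2 * s ≤ M ∧ a + s + N ≤ l + M ∧ a + s ≤ N} := by
  refine Finset.card_bij' (fun a _ => a - (N + s - M)) (fun a _ => a + (N + s - M)) ?_ ?_ ?_ ?_
  all_goals
    intro a ha
    simp only [Finset.mem_filter, Finset.mem_range] at ha ⊢
    omega

lemma main_card (d : ℕ) : ∀ (B N : ℕ) (ℓ : Fin (d + 1) → ℕ), N ≤ B →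
    #{ν ∈ Fintype.piFinset (fun _ : Fin d => Finset.range (B + 1)) |
      TT d ℓ ν ∧ (∑ i, ν i) + N ≤ ∑ i, ℓ i ∧ (∑ i, ν i) ≤ N} =
    #{x ∈ Fintype.piFinset (fun _ : Fin (d + 1) => Finset.range (B + 1)) |
      (∀ i, x i ≤ ℓ i) ∧ ∑ i, x i = N} := by
  induction d with
  | zero =>
    intro B N ℓ hB
    rw [box_card_succ]
    simp [TT]
    by_cases h : N ≤ ℓ 0
    · have : {x ∈ Finset.range (B + 1) | x ≤ ℓ 0 ∧ x = N} = {N} := by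
        ext x
        simp only [Finset.mem_filter, Finset.mem_range, Finset.mem_singleton]
        omega
      rw [this]
      simp [h]
    · have : {x ∈ Finset.range (B + 1) | x ≤ ℓ 0 ∧ x = N} = ∅ := by
        ext x
        simp only [Finset.mem_filter, Finset.mem_range, Finset.notMem_empty, iff_false]
        omega
      rw [this]
      simp [h]
  | succ d ih =>
    intro B N ℓ hB
    have key : ∀ a ∈ Finset.range (B + 1),
        (∑ y ∈ Fintype.piFinset (fun _ : Fin (d + 1) => Finset.range (B + 1)),
          if (∀ i, (Fin.cons a y : Fin (d + 2) → ℕ) i ≤ ℓ i) ∧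
            ∑ i, (Fin.cons a y : Fin (d + 2) → ℕ) i = N then 1 else 0) =
        ∑ y ∈ Fintype.piFinset (fun _ : Fin d => Finset.range (B + 1)),
          if TT d (fun i => ℓ i.succ) y ∧ (a ≤ ℓ 0 ∧ a ≤ N ∧
            (∑ i, y i) + (N - a) ≤ ∑ i : Fin (d + 1), ℓ i.succ ∧ (∑ i, y i) ≤ N - a)
          then 1 else 0 := by
      intro a _
      by_cases h : a ≤ ℓ 0 ∧ a ≤ N
      · have := ih B (N - a) (fun i => ℓ i.succ) (by omega)
        rw [Finset.card_filter, Finset.card_filter] at this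
        simp only [h.1, h.2, true_and]
        rw [this]
        refine Finset.sum_congr rfl fun y _ => ?_
        congr 1
        simp only [Fin.forall_fin_succ (n := d + 1), Fin.sum_univ_succ (n := d + 1), Fin.cons_zero,
          Fin.cons_succ, h.1, true_and, eq_iff_iff]
        refine and_congr_right fun _ => ?_
        omega
      · rw [Finset.sum_eq_zero, Finset.sum_eq_zero]
        · intro y _
          rw [if_neg]
          tauto
        · intro y _
          rw [if_neg]
          simp only [Fin.forall_fin_succ (n := d + 1), Fin.sum_univ_succ (n := d + 1), Fin.cons_zero,
            Fin.cons_succ]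
          omega
    rw [box_card_succ B (d + 1), Finset.sum_congr rfl key, box_card_succ, Finset.sum_comm,
      Finset.sum_comm (s := Finset.range (B + 1))]
    refine Finset.sum_congr rfl fun y _ => ?_
    by_cases hT : TT d (fun i => ℓ i.succ) y
    · simp only [TT_cons, hT, true_and]
      rw [← Finset.card_filter, ← Finset.card_filter, interval_card _ _ _ _ _ hB]
      congr 1
      ext a
      simp only [Fin.sum_univ_succ (n := d + 1), Fin.sum_univ_succ (n := d), Fin.cons_zero, Fin.cons_succ,
        Finset.mem_filter]
      tauto
    · simp [TT_cons, hT]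

lemma simplex_card (d B N : ℕ) (hB : N ≤ B) :
    #{x ∈ Fintype.piFinset (fun _ : Fin (d + 1) => Finset.range (B + 1)) |
      ∑ i, x i = N} = (N + d).choose d := by
  have h1 : #(Finset.piAntidiag (Finset.univ : Finset (Fin (d + 1))) N) = (N + d).choose d := by
    rw [← Finset.map_sym_eq_piAntidiag, Finset.card_map, Finset.sym_univ, Finset.card_univ,
      Sym.card_sym_eq_choose, Fintype.card_fin]
    rw [show d + 1 + N - 1 = N + d by omega, Nat.choose_symm_add]
  rw [← h1]
  congr 1
  ext x
  simp only [Finset.mem_filter, Fintype.mem_piFinset, Finset.mem_piAntidiag, Finset.mem_range]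
  constructor
  · rintro ⟨_, h⟩; simp [h]
  · rintro ⟨h, _⟩
    refine ⟨fun i => ?_, h⟩
    have h : ∑ i, x i = N := h
    have : x i ≤ ∑ i, x i :=
      Finset.single_le_sum (f := x) (fun i _ => Nat.zero_le _) (Finset.mem_univ i)
    omega

lemma shifted_card (d N : ℕ) (hd : 1 ≤ d) (k : Fin (d + 1)) (l : ℕ) (hl : l ≤ N) :
    #{x ∈ Fintype.piFinset (fun _ : Fin (d + 1) => Finset.range (N + 1)) |
      ∑ i, x i = N ∧ l < x k} = (N - l + d - 1).choose d := by
  rcases hl.eq_or_lt with rfl | hl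
  · rw [Nat.choose_eq_zero_of_lt (by omega), Finset.card_eq_zero, Finset.filter_eq_empty_iff]
    rintro x _ ⟨h, h'⟩
    have : x k ≤ ∑ i, x i :=
      Finset.single_le_sum (f := x) (fun i _ => Nat.zero_le _) (Finset.mem_univ k)
    omega
  · rw [show N - l + d - 1 = (N - l - 1) + d by omega, ← simplex_card d N (N - l - 1) (by omega)]
    have hsum : ∀ x : Fin (d + 1) → ℕ, ∑ i, (x + Pi.single k (l + 1) : Fin (d + 1) → ℕ) i = ∑ i, x i + (l + 1) := by
      intro x; simp [Finset.sum_add_distrib]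
    symm
    refine Finset.card_bij (fun x _ => x + Pi.single k (l + 1)) ?_ ?_ ?_
    · intro x hx
      simp only [Finset.mem_filter, Fintype.mem_piFinset, Finset.mem_range] at hx ⊢
      have hs := hsum x
      refine ⟨fun i => ?_, by omega, by simp; omega⟩
      have : (x + Pi.single k (l + 1) : Fin (d + 1) → ℕ) i ≤
          ∑ i, (x + Pi.single k (l + 1) : Fin (d + 1) → ℕ) i :=
        Finset.single_le_sum (f := x + Pi.single k (l + 1)) (fun i _ => Nat.zero_le _)
          (Finset.mem_univ i)
      omega
    · intro x _ y _ h
      exact add_right_cancel h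
    · intro x hx
      simp only [Finset.mem_filter, Fintype.mem_piFinset, Finset.mem_range] at hx
      have he : x - Pi.single k (l + 1) + Pi.single k (l + 1) = x := by
        ext i
        by_cases h : i = k
        · subst h; simp; omega
        · simp [h]
      refine ⟨x - Pi.single k (l + 1), ?_, he⟩
      have hs := hsum (x - Pi.single k (l + 1))
      rw [he] at hs
      simp only [Finset.mem_filter, Fintype.mem_piFinset, Finset.mem_range]
      refine ⟨fun i => ?_, by omega⟩
      have := hx.1 i
      simp only [Pi.sub_apply]
      omega

theorem stmt17 (d N : ℕ) (hd : 3 ≤ d) (hN : 1 ≤ N) (ℓ : Fin (d + 1) → ℕ)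
    (hle : ∀ i, ℓ i ≤ N)
    (hpair : ∀ i j : Fin (d + 1), i < j → N ≤ ℓ i + ℓ j) :
    ((Hd d N ℓ).card : ℤ) =
      ((N + d).choose d : ℤ) - ∑ k : Fin (d + 1), ((N - ℓ k + d - 1).choose d : ℤ) := by
  have h1 : (Hd d N ℓ).card =
      #{x ∈ Fintype.piFinset (fun _ : Fin (d + 1) => Finset.range (N + 1)) |
        (∀ i, x i ≤ ℓ i) ∧ ∑ i, x i = N} := by
    rw [← main_card d N N ℓ le_rfl]
    congr 1
    ext ν
    simp only [Hd, TT, Finset.mem_filter, and_assoc]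
  have h2 := Finset.card_filter_add_card_filter_not
    (s := {x ∈ Fintype.piFinset (fun _ : Fin (d + 1) => Finset.range (N + 1)) | ∑ i, x i = N})
    (fun x => ∀ i, x i ≤ ℓ i)
  rw [simplex_card d N N le_rfl, Finset.filter_filter, Finset.filter_filter] at h2
  have h3 : #{x ∈ Fintype.piFinset (fun _ : Fin (d + 1) => Finset.range (N + 1)) |
      ∑ i, x i = N ∧ ¬ ∀ i, x i ≤ ℓ i} = ∑ k, (N - ℓ k + d - 1).choose d := by
    rw [← Finset.sum_congr rfl (fun k _ => shifted_card d N (by omega) k (ℓ k) (hle k)),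
      ← Finset.card_biUnion]
    · congr 1
      ext x
      simp only [Finset.mem_filter, Finset.mem_biUnion, Finset.mem_univ, true_and, not_forall,
        not_le]
      tauto
    · intro i _ j _ hij
      rw [Function.onFun, Finset.disjoint_left]
      intro x hx hy
      simp only [Finset.mem_filter] at hx hy
      have hp : N ≤ ℓ i + ℓ j := by
        rcases lt_or_gt_of_ne hij with h | h
        · exact hpair i j h
        · rw [add_comm]; exact hpair j i h
      have := Finset.sum_le_sum_of_subset (f := x) (Finset.subset_univ {i, j})
      rw [Finset.sum_pair hij] at this
      omega
  rw [h3] at h2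
  simp only [and_comm (a := ∀ i, _ ≤ ℓ i)] at h1
  rw [h1, ← h2]
  push_cast
  ring
end
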